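/- arXiv:1508.01340 — 4 statements merged into one kernel-verified Lean document; each statement's English description precedes it below -/
import Mathlib

section
/- There exists a constant C, depending only on n_S and n_T, such that for every m ≥ 1, every graph sample with m edges, and every coclustering model M, one has |c(M) − m·(Ĥ_S + Ĥ_T − Î_M)| ≤ C·log(m+1), where Ĥ_S = −Σ_{i : m_{i.}>0} (m_{i.}/m) log(m_{i.}/m), Ĥ_T = −Σ_{j : m_{.j}>0} (m_{.j}/m) log(m_{.j}/m), and Î_M = Σ_{(κ,λ) : m^{ST}_{κλ}>0} (m^{ST}_{κλ}/m) · log( (m^{ST}_{κλ}/m) / ((m^S_{κ.}/m)·(m^T_{.λ}/m)) ). -/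
open Finset Filter

/-- Stirling numbers of the second kind `S(n,k)`. -/
def stirling2 : ℕ → ℕ → ℕ
  | 0, 0 => 1
  | 0, _ + 1 => 0
  | _ + 1, 0 => 0
  | n + 1, k + 1 => (k + 1) * stirling2 n (k + 1) + stirling2 n k

/-- `B(n,k) = Σ_{i=1}^k S(n,i)`: number of divisions of `n` elements into at most `k` subsets. -/
def bellPartial (n k : ℕ) : ℕ := ∑ i ∈ Finset.Icc 1 k, stirling2 n i

/-- A coclustering model: surjective cluster maps `f_S : S → {1,…,k_S}`,
`f_T : T → {1,…,k_T}` with `1 ≤ k_S`, `1 ≤ k_T`. -/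
structure CoclusterModel (S T : Type*) [Fintype S] [Fintype T] where
  kS : ℕ
  kT : ℕ
  kS_pos : 1 ≤ kS
  kT_pos : 1 ≤ kT
  fS : S → Fin kS
  fT : T → Fin kT
  fS_surj : Function.Surjective fS
  fT_surj : Function.Surjective fT

/-- Cocluster edge counts `m^{ST}_{κλ}` induced by a model on a count matrix `w`. -/
def coCount {S T : Type*} [Fintype S] [Fintype T]
    (M : CoclusterModel S T) (w : S → T → ℕ) (κ : Fin M.kS) (lam : Fin M.kT) : ℕ :=
  ∑ i : S, ∑ j : T, if M.fS i = κ ∧ M.fT j = lam then w i j else 0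

/-- The MODL evaluation criterion `c_m(M)` for a coclustering model `M` on a graph
sample given by the count matrix `w` with `m` edges. -/
noncomputable def cCrit {S T : Type*} [Fintype S] [Fintype T]
    (M : CoclusterModel S T) (w : S → T → ℕ) (m : ℕ) : ℝ :=
  Real.log (Fintype.card S : ℝ) + Real.log (Fintype.card T : ℝ)
  + Real.log (bellPartial (Fintype.card S) M.kS : ℝ)
  + Real.log (bellPartial (Fintype.card T) M.kT : ℝ)
  + Real.log ((m + M.kS * M.kT - 1).choose (M.kS * M.kT - 1) : ℝ)
  + ∑ κ : Fin M.kS,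
      Real.log ((((∑ lam : Fin M.kT, coCount M w κ lam)
          + (Finset.univ.filter (fun i : S => M.fS i = κ)).card - 1).choose
          ((Finset.univ.filter (fun i : S => M.fS i = κ)).card - 1) : ℕ) : ℝ)
  + ∑ lam : Fin M.kT,
      Real.log ((((∑ κ : Fin M.kS, coCount M w κ lam)
          + (Finset.univ.filter (fun j : T => M.fT j = lam)).card - 1).choose
          ((Finset.univ.filter (fun j : T => M.fT j = lam)).card - 1) : ℕ) : ℝ)
  + Real.log (m.factorial : ℝ)
  - ∑ κ : Fin M.kS, ∑ lam : Fin M.kT, Real.log ((coCount M w κ lam).factorial : ℝ)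
  + ∑ κ : Fin M.kS, Real.log ((∑ lam : Fin M.kT, coCount M w κ lam).factorial : ℝ)
  - ∑ i : S, Real.log ((∑ j : T, w i j).factorial : ℝ)
  + ∑ lam : Fin M.kT, Real.log ((∑ κ : Fin M.kS, coCount M w κ lam).factorial : ℝ)
  - ∑ j : T, Real.log ((∑ i : S, w i j).factorial : ℝ)


noncomputable def rr (n : ℕ) : ℝ := Real.log (n.factorial : ℝ) - ((n : ℝ) * Real.log n - n)

lemma rr_aux (n : ℕ) : 0 ≤ rr (n+1) ∧ rr (n+1) ≤ 1 + Real.log ((n:ℝ)+1) := by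
  induction n with
  | zero => simp [rr]
  | succ n ih =>
    have e : rr (n+1+1) = rr (n+1) + 1 - ((n:ℝ)+1) * (Real.log ((n:ℝ)+2) - Real.log ((n:ℝ)+1)) := by
      unfold rr
      rw [Nat.factorial_succ (n+1)]
      have h1 : (((n+1).factorial : ℕ) : ℝ) ≠ 0 := by positivity
      have h2 : (((n+1+1 : ℕ)) : ℝ) ≠ 0 := by positivity
      rw [Nat.cast_mul, Real.log_mul h2 h1]
      push_cast
      rw [show (n:ℝ)+1+1 = n+2 by ring]
      ring
    have p1 : (0:ℝ) < (n:ℝ)+1 := by positivity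
    have p2 : (0:ℝ) < (n:ℝ)+2 := by positivity
    have u := Real.log_le_sub_one_of_pos (div_pos p2 p1)
    have v := Real.log_le_sub_one_of_pos (div_pos p1 p2)
    rw [Real.log_div p2.ne' p1.ne'] at u
    rw [Real.log_div p1.ne' p2.ne'] at v
    have u' : ((n:ℝ)+1) * (Real.log ((n:ℝ)+2) - Real.log ((n:ℝ)+1)) ≤ 1 := by
      calc _ ≤ ((n:ℝ)+1) * (((n:ℝ)+2)/((n:ℝ)+1) - 1) := by gcongr
        _ = 1 := by field_simp; ring
    have v' : ((n:ℝ)+2) * (Real.log ((n:ℝ)+1) - Real.log ((n:ℝ)+2)) ≤ -1 := by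
      calc _ ≤ ((n:ℝ)+2) * (((n:ℝ)+1)/((n:ℝ)+2) - 1) := by gcongr
        _ = -1 := by field_simp; ring
    rw [e]
    push_cast
    rw [show (n:ℝ)+1+1 = n+2 by ring]
    constructor
    · linarith [ih.1]
    · nlinarith [ih.2]

lemma one_le_two_log {m : ℕ} (hm : 1 ≤ m) : 1 ≤ 2 * Real.log ((m:ℝ)+1) := by
  have h : Real.log 2 ≤ Real.log ((m:ℝ)+1) := by
    apply Real.log_le_log (by norm_num)
    have : (1:ℝ) ≤ m := by exact_mod_cast hm
    linarith
  linarith [Real.log_two_gt_d9]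

lemma rr_bound {m n : ℕ} (hm : 1 ≤ m) (h : n ≤ m) : |rr n| ≤ 3 * Real.log ((m:ℝ)+1) := by
  have h1 := one_le_two_log hm
  rcases n with _ | n
  · simp [rr]; linarith
  · obtain ⟨a, b⟩ := rr_aux n
    rw [abs_of_nonneg a]
    have : Real.log ((n:ℝ)+1) ≤ Real.log ((m:ℝ)+1) := by
      apply Real.log_le_log (by positivity)
      have : (n:ℝ) ≤ m := by exact_mod_cast (Nat.le_of_succ_le h)
      linarith
    linarith

lemma choose_bd (n k : ℕ) : (n+k).choose k ≤ (n+1)^k := by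
  induction k with
  | zero => simp
  | succ k ih =>
    have h := Nat.add_one_mul_choose_eq (n+k) k
    have : (k+1) * (n+(k+1)).choose (k+1) ≤ (k+1) * (n+1)^(k+1) := by
      calc (k+1) * (n+(k+1)).choose (k+1) = (n+k+1) * (n+k).choose k := by
            rw [h]; rw [← add_assoc]; ring
        _ ≤ ((k+1)*(n+1)) * (n+1)^k := by
            apply Nat.mul_le_mul _ ih
            nlinarith [Nat.zero_le (k*n)]
        _ = _ := by ring
    exact Nat.le_of_mul_le_mul_left this (by omega)

lemma log_nat_mono {a b : ℕ} (h : a ≤ b) : Real.log (a:ℝ) ≤ Real.log (b:ℝ) := by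
  rcases Nat.eq_zero_or_pos a with rfl | ha
  · simpa using Real.log_natCast_nonneg b
  · exact Real.log_le_log (by exact_mod_cast ha) (by exact_mod_cast h)

lemma log_choose_bd {m n : ℕ} (k : ℕ) (h : n ≤ m) :
    Real.log (((n+k-1).choose (k-1) : ℕ) : ℝ) ≤ k * Real.log ((m:ℝ)+1) := by
  have L : 0 ≤ Real.log ((m:ℝ)+1) := Real.log_nonneg (by simp)
  rcases k with _ | k
  · simp
  · have := log_nat_mono ((choose_bd n k).trans (Nat.pow_le_pow_left (Nat.succ_le_succ h) k))
    simp only [Nat.add_sub_cancel, ← add_assoc]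
    refine this.trans ?_
    push_cast
    rw [Real.log_pow]
    nlinarith

lemma bell_mono (n : ℕ) {k l : ℕ} (h : k ≤ l) : bellPartial n k ≤ bellPartial n l := by
  unfold bellPartial
  exact Finset.sum_le_sum_of_subset (Finset.Icc_subset_Icc_right h)

lemma ent {ι : Type*} [Fintype ι] (h : ι → ℕ) {m : ℕ} (hm : 1 ≤ m) (hs : ∑ i, h i = m) :
    (m:ℝ) * ∑ i, (h i : ℝ)/m * Real.log ((h i : ℝ)/m)
      = ∑ i, (h i : ℝ) * Real.log (h i) - m * Real.log m := by
  have m0 : (m:ℝ) ≠ 0 := by positivity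
  have : (m:ℝ) * Real.log m = ∑ i, (h i : ℝ) * Real.log m := by
    rw [← Finset.sum_mul, ← Nat.cast_sum, hs]
  rw [this, ← Finset.sum_sub_distrib, Finset.mul_sum]
  refine Finset.sum_congr rfl fun i _ => ?_
  rcases Nat.eq_zero_or_pos (h i) with h0 | h0
  · simp [h0]
  · have : (h i : ℝ) ≠ 0 := by positivity
    rw [Real.log_div this m0]
    field_simp

lemma mutinf {α β : Type*} [Fintype α] [Fintype β] (q : α → β → ℕ) {m : ℕ} (hm : 1 ≤ m)
    (hs : ∑ a, ∑ b, q a b = m) :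
    (m:ℝ) * ∑ a, ∑ b, ((q a b : ℝ)/m) * Real.log (((q a b : ℝ)/m) /
        ((((∑ b', q a b' : ℕ) : ℝ)/m) * (((∑ a', q a' b : ℕ) : ℝ)/m)))
      = ∑ a, ∑ b, (q a b : ℝ) * Real.log (q a b)
        - ∑ a, ((∑ b, q a b : ℕ) : ℝ) * Real.log ((∑ b, q a b : ℕ) : ℝ)
        - ∑ b, ((∑ a, q a b : ℕ) : ℝ) * Real.log ((∑ a, q a b : ℕ) : ℝ)
        + m * Real.log m := by
  have m0 : (m:ℝ) ≠ 0 := by positivity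
  have e1 : (m:ℝ) * Real.log m = ∑ a, ∑ b, (q a b : ℝ) * Real.log m := by
    simp_rw [← Finset.sum_mul]
    congr 1
    rw [← hs]; push_cast; rfl
  have e2 : ∑ a, ((∑ b, q a b : ℕ) : ℝ) * Real.log ((∑ b, q a b : ℕ) : ℝ)
      = ∑ a, ∑ b, (q a b : ℝ) * Real.log ((∑ b, q a b : ℕ) : ℝ) := by
    refine Finset.sum_congr rfl fun a _ => ?_
    rw [← Finset.sum_mul, ← Nat.cast_sum]
  have e3 : ∑ b, ((∑ a, q a b : ℕ) : ℝ) * Real.log ((∑ a, q a b : ℕ) : ℝ)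
      = ∑ a, ∑ b, (q a b : ℝ) * Real.log ((∑ a, q a b : ℕ) : ℝ) := by
    rw [Finset.sum_comm]
    refine Finset.sum_congr rfl fun a _ => ?_
    rw [← Finset.sum_mul, ← Nat.cast_sum]
  rw [e1, e2, e3]
  simp_rw [← Finset.sum_sub_distrib, ← Finset.sum_add_distrib, Finset.mul_sum]
  refine Finset.sum_congr rfl fun a _ => Finset.sum_congr rfl fun b _ => ?_
  rcases Nat.eq_zero_or_pos (q a b) with h0 | h0
  · simp [h0]
  · have p : (q a b : ℝ) ≠ 0 := by positivity
    have p1 : ((∑ b', q a b' : ℕ) : ℝ) ≠ 0 := by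
      have := Finset.single_le_sum (f := fun b' => q a b') (fun _ _ => Nat.zero_le _) (Finset.mem_univ b)
      exact_mod_cast (by omega : (∑ b', q a b') ≠ 0)
    have p2 : ((∑ a', q a' b : ℕ) : ℝ) ≠ 0 := by
      have := Finset.single_le_sum (f := fun a' => q a' b) (fun _ _ => Nat.zero_le _) (Finset.mem_univ a)
      exact_mod_cast (by omega : (∑ a', q a' b) ≠ 0)
    rw [Real.log_div (div_ne_zero p m0) (mul_ne_zero (div_ne_zero p1 m0) (div_ne_zero p2 m0)),
      Real.log_mul (div_ne_zero p1 m0) (div_ne_zero p2 m0), Real.log_div p m0,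
      Real.log_div p1 m0, Real.log_div p2 m0]
    field_simp
    ring

lemma logfact_sum {ι : Type*} [Fintype ι] (h : ι → ℕ) {m : ℕ} (hs : ∑ i, h i = m) :
    ∑ i, Real.log ((h i).factorial : ℝ)
      = ∑ i, rr (h i) + ∑ i, (h i : ℝ) * Real.log (h i) - m := by
  rw [← hs, Nat.cast_sum, ← Finset.sum_add_distrib, ← Finset.sum_sub_distrib]
  refine Finset.sum_congr rfl fun i _ => ?_
  unfold rr; ring

lemma rr_sum {ι : Type*} [Fintype ι] (h : ι → ℕ) {m : ℕ} (hm : 1 ≤ m) (hs : ∑ i, h i = m)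
    {N : ℕ} (hN : Fintype.card ι ≤ N) :
    |∑ i, rr (h i)| ≤ N * (3 * Real.log ((m:ℝ)+1)) := by
  have L : 0 ≤ Real.log ((m:ℝ)+1) := Real.log_nonneg (by simp)
  refine (Finset.abs_sum_le_sum_abs _ _).trans ?_
  calc _ ≤ ∑ i : ι, 3 * Real.log ((m:ℝ)+1) := by
        refine Finset.sum_le_sum fun i _ => rr_bound hm ?_
        rw [← hs]
        exact Finset.single_le_sum (fun _ _ => Nat.zero_le _) (Finset.mem_univ i)
    _ = (Fintype.card ι : ℝ) * (3 * Real.log ((m:ℝ)+1)) := by simp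
    _ ≤ _ := by gcongr

lemma choose_sum {ι σ : Type*} [Fintype ι] [Fintype σ] [DecidableEq ι] (f : σ → ι) (h : ι → ℕ)
    {m : ℕ} (hs : ∑ i, h i = m) :
    |∑ κ : ι, Real.log (((h κ + (Finset.univ.filter (fun i : σ => f i = κ)).card - 1).choose
          ((Finset.univ.filter (fun i : σ => f i = κ)).card - 1) : ℕ) : ℝ)|
      ≤ Fintype.card σ * Real.log ((m:ℝ)+1) := by
  rw [abs_of_nonneg (Finset.sum_nonneg fun _ _ => Real.log_natCast_nonneg _)]
  refine (Finset.sum_le_sum fun κ _ => log_choose_bd (m := m) _ ?_).trans ?_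
  · rw [← hs]
    exact Finset.single_le_sum (fun _ _ => Nat.zero_le _) (Finset.mem_univ κ)
  · rw [← Finset.sum_mul, ← Nat.cast_sum]
    rw [← Finset.card_eq_sum_card_fiberwise (f := f) (s := Finset.univ) (t := Finset.univ) (by simp)]
    simp

lemma coCount_sum {S T : Type*} [Fintype S] [Fintype T]
    (M : CoclusterModel S T) (w : S → T → ℕ) :
    ∑ κ, ∑ lam, coCount M w κ lam = ∑ i, ∑ j, w i j := by
  unfold coCount
  have : ∀ κ, ∑ lam, ∑ i : S, ∑ j : T, (if M.fS i = κ ∧ M.fT j = lam then w i j else 0)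
      = ∑ i : S, ∑ j : T, (if M.fS i = κ then w i j else 0) := by
    intro κ
    rw [Finset.sum_comm]
    refine Finset.sum_congr rfl fun i _ => ?_
    rw [Finset.sum_comm]
    refine Finset.sum_congr rfl fun j _ => ?_
    simp [ite_and]
  simp_rw [this]
  rw [Finset.sum_comm]
  refine Finset.sum_congr rfl fun i _ => ?_
  rw [Finset.sum_comm]
  simp

/-- there is a constant `C` depending only on `n_S` and `n_T` such that
for every `m ≥ 1`, every graph sample with `m` edges and every coclustering model `M`,
`|c(M) − m·(Ĥ_S + Ĥ_T − Î_M)| ≤ C·log(m+1)`. -/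
theorem modl_criterion_asymptotic_expansion
    {S T : Type*} [Fintype S] [Fintype T]
    (hS : 1 ≤ Fintype.card S) (hT : 1 ≤ Fintype.card T) :
    ∃ C : ℝ, ∀ m : ℕ, 1 ≤ m → ∀ w : S → T → ℕ, (∑ i : S, ∑ j : T, w i j) = m →
      ∀ M : CoclusterModel S T,
        |cCrit M w m -
          (m : ℝ) *
            ((-∑ i : S, ((∑ j : T, w i j : ℕ) : ℝ) / m
                * Real.log (((∑ j : T, w i j : ℕ) : ℝ) / m))
             + (-∑ j : T, ((∑ i : S, w i j : ℕ) : ℝ) / m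
                * Real.log (((∑ i : S, w i j : ℕ) : ℝ) / m))
             - ∑ κ : Fin M.kS, ∑ lam : Fin M.kT,
                 ((coCount M w κ lam : ℝ) / m) *
                   Real.log (((coCount M w κ lam : ℝ) / m) /
                     ((((∑ lam' : Fin M.kT, coCount M w κ lam' : ℕ) : ℝ) / m)
                       * (((∑ κ' : Fin M.kS, coCount M w κ' lam : ℕ) : ℝ) / m))))|
        ≤ C * Real.log ((m : ℝ) + 1) := by
  classical
  set a := Fintype.card S with ha
  set b := Fintype.card T with hb
  refine ⟨2 * (Real.log a + Real.log b + Real.log (bellPartial a a : ℝ)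
    + Real.log (bellPartial b b : ℝ)) + (a * b : ℕ) + a + b
    + 3 * (1 + (a * b : ℕ) + a + a + b + b), ?_⟩
  intro m hm w hw M
  have hL := one_le_two_log hm
  have kS : M.kS ≤ a := by simpa using Fintype.card_le_of_surjective _ M.fS_surj
  have kT : M.kT ≤ b := by simpa using Fintype.card_le_of_surjective _ M.fT_surj
  have q1 : ∑ κ, ∑ lam, coCount M w κ lam = m := (coCount_sum M w).trans hw
  have q2 : ∑ lam, ∑ κ, coCount M w κ lam = m := by rw [Finset.sum_comm]; exact q1
  have w2 : ∑ j, ∑ i, w i j = m := by rw [Finset.sum_comm]; exact hw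
  have q3 : ∑ p : Fin M.kS × Fin M.kT, coCount M w p.1 p.2 = m := by
    rw [Fintype.sum_prod_type]; exact q1
  have f1 := logfact_sum _ q1
  have f2 := logfact_sum _ q2
  have f3 := logfact_sum _ hw
  have f4 := logfact_sum _ w2
  have f5 := logfact_sum _ q3
  have r1 := rr_sum _ hm q1 (N := a) (by simpa using kS)
  have r2 := rr_sum _ hm q2 (N := b) (by simpa using kT)
  have r3 := rr_sum _ hm hw (N := a) le_rfl
  have r4 := rr_sum _ hm w2 (N := b) le_rfl
  have r5 := rr_sum _ hm q3 (N := a * b) (by simpa using Nat.mul_le_mul kS kT)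
  have r6 := rr_bound hm (le_refl m)
  have f6 : Real.log (m.factorial : ℝ) = rr m + (m * Real.log m - m) := by unfold rr; ring
  have c1 := choose_sum M.fS _ q1
  have c2 := choose_sum M.fT _ q2
  have c3 := log_choose_bd (M.kS * M.kT) (le_refl m)
  have c3' := Real.log_natCast_nonneg ((m + M.kS * M.kT - 1).choose (M.kS * M.kT - 1))
  have c4 : ((M.kS * M.kT : ℕ) : ℝ) * Real.log ((m:ℝ)+1)
      ≤ ((a * b : ℕ) : ℝ) * Real.log ((m:ℝ)+1) := by
    have : M.kS * M.kT ≤ a * b := Nat.mul_le_mul kS kT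
    have : ((M.kS * M.kT : ℕ) : ℝ) ≤ ((a * b : ℕ) : ℝ) := by exact_mod_cast this
    gcongr
    linarith
  have b1 := log_nat_mono (bell_mono a kS)
  have b2 := log_nat_mono (bell_mono b kT)
  have b3 := Real.log_natCast_nonneg (bellPartial a M.kS)
  have b4 := Real.log_natCast_nonneg (bellPartial b M.kT)
  have b5 := Real.log_natCast_nonneg a
  have b6 := Real.log_natCast_nonneg b
  have K : ∀ x : ℝ, 0 ≤ x → x ≤ x * (2 * Real.log ((m:ℝ)+1)) := fun x hx =>
    le_mul_of_one_le_right hx hL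
  have k1 := K _ b5
  have k2 := K _ b6
  have k3 := K _ (b3.trans b1)
  have k4 := K _ (b4.trans b2)
  rw [Fintype.sum_prod_type, Fintype.sum_prod_type, Fintype.sum_prod_type] at f5
  rw [Fintype.sum_prod_type] at r5
  have E1 := ent _ hm hw
  have E2 := ent _ hm w2
  have E3 := mutinf _ hm q1
  rw [mul_sub, mul_add, mul_neg, mul_neg, E1, E2, E3]
  unfold cCrit
  rw [← ha, ← hb, f1, f2, f3, f4, f5, f6]
  rw [abs_le] at *
  constructor <;> linarith
end

section
/- Fix a joint probability mass function p on S × T and a coclustering model M = (f_S, f_T). Suppose (m_{ij}(m))_{m≥1} is a sequence of graph samples, where the sample of index m has m edges, such that m_{ij}(m)/m → p(i,j) as m → ∞ for every (i,j) ∈ S × T. Then c_m(M)/m converges, as m → ∞, to H(p_S) + H(p_T) − I((f_S, f_T)∗p), where p_S and p_T are the marginals of p, H denotes Shannon entropy, I denotes mutual information, and (f_S, f_T)∗p is the grouped joint pmf on {1,…,k_S} × {1,…,k_T}. -/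
open Finset Filter

/-- Shannon entropy `H(p) = −Σ_x p(x) log p(x)` (natural log, `0·log 0 = 0`). -/
noncomputable def shannonEntropy {X : Type*} [Fintype X] (p : X → ℝ) : ℝ :=
  -∑ x : X, p x * Real.log (p x)

/-- Mutual information `I(p) = Σ_{x,y} p(x,y) log(p(x,y)/(p_X(x)·p_Y(y)))`. -/
noncomputable def mutualInfo {X Y : Type*} [Fintype X] [Fintype Y] (p : X × Y → ℝ) : ℝ :=
  ∑ z : X × Y, p z * Real.log (p z / ((∑ y : Y, p (z.1, y)) * (∑ x : X, p (x, z.2))))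

/-- The grouped joint pmf `(f,g)∗p` on `X' × Y'`. -/
def pushJoint {X Y X' Y' : Type*} [Fintype X] [Fintype Y]
    [DecidableEq X'] [DecidableEq Y'] (f : X → X') (g : Y → Y') (p : X × Y → ℝ) :
    X' × Y' → ℝ :=
  fun z => ∑ x : X, ∑ y : Y, if f x = z.1 ∧ g y = z.2 then p (x, y) else 0

lemma logfac_upper (n : ℕ) :
    Real.log (n.factorial : ℝ) ≤ n * Real.log n - n + Real.log n + 1 := by
  induction n with
  | zero => simp
  | succ n ih =>
    rcases Nat.eq_zero_or_pos n with rfl | hn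
    · simp
    · have hn' : (0:ℝ) < n := by exact_mod_cast hn
      have h1 : Real.log (((n + 1).factorial : ℕ) : ℝ)
          = Real.log ((n:ℝ) + 1) + Real.log (n.factorial : ℝ) := by
        rw [Nat.factorial_succ]; push_cast
        rw [Real.log_mul (by positivity) (by positivity)]
      have h2 := Real.log_le_sub_one_of_pos (show (0:ℝ) < n / (n + 1) by positivity)
      rw [Real.log_div (by positivity) (by positivity)] at h2
      have h3 : (n:ℝ) / (n + 1) - 1 = - (1 / (n + 1)) := by field_simp; ring
      rw [h3] at h2
      have h4 : 1 ≤ ((n:ℝ) + 1) * (Real.log (n + 1) - Real.log n) := by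
        have h5 : (1:ℝ) = (n + 1) * (1 / (n + 1)) := by field_simp
        calc (1:ℝ) = (n + 1) * (1 / (n + 1)) := h5
          _ ≤ _ := mul_le_mul_of_nonneg_left (by linarith) (by positivity)
      rw [h1]; push_cast
      nlinarith

lemma logfac_lower (n : ℕ) :
    n * Real.log n - n ≤ Real.log (n.factorial : ℝ) := by
  rcases Nat.eq_zero_or_pos n with rfl | hn
  · simp
  · have h := Stirling.le_log_factorial_stirling (n := n) (by omega)
    have h1 : 0 ≤ Real.log (n:ℝ) := Real.log_natCast_nonneg n
    have h2 : 0 ≤ Real.log (2 * Real.pi) :=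
      Real.log_nonneg (by have := Real.pi_gt_three; linarith)
    linarith

lemma log_add_div (c : ℝ) :
    Tendsto (fun m : ℕ => Real.log ((m:ℝ) + c) / m) atTop (nhds 0) := by
  have h := (Real.isLittleO_log_id_atTop.tendsto_div_nhds_zero).comp
    (tendsto_atTop_add_const_right atTop c (tendsto_natCast_atTop_atTop (R := ℝ)))
  have h2 : Tendsto (fun m : ℕ => ((m:ℝ) + c) / m) atTop (nhds (1 + 0)) := by
    have h3 : Tendsto (fun m : ℕ => (1:ℝ) + c / m) atTop (nhds (1 + 0)) :=
      tendsto_const_nhds.add (tendsto_const_div_atTop_nhds_zero_nat c)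
    refine h3.congr' ?_
    filter_upwards [eventually_ge_atTop 1] with m hm
    have : (m:ℝ) ≠ 0 := by positivity
    field_simp
  have h4 := h.mul h2
  simp only [zero_mul] at h4
  refine h4.congr' ?_
  have h5 : ∀ᶠ m : ℕ in atTop, (0:ℝ) < (m:ℝ) + c :=
    (tendsto_atTop_add_const_right atTop c
      (tendsto_natCast_atTop_atTop (R := ℝ))).eventually_gt_atTop 0
  filter_upwards [h5] with m hm
  simp only [Function.comp, id]
  field_simp

lemma choose_lim (n : ℕ → ℕ) (hn : ∀ m, 1 ≤ m → n m ≤ m) (k : ℕ) :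
    Tendsto (fun m : ℕ => Real.log (((n m + k - 1).choose (k - 1) : ℕ) : ℝ) / m)
      atTop (nhds 0) := by
  have h := (log_add_div k).const_mul (k:ℝ)
  rw [mul_zero] at h
  refine squeeze_zero' (Eventually.of_forall fun m =>
    div_nonneg (Real.log_natCast_nonneg _) (Nat.cast_nonneg _)) ?_ h
  filter_upwards [eventually_ge_atTop 1] with m hm
  rw [← mul_div_assoc]
  apply div_le_div_of_nonneg_right _ (Nat.cast_nonneg _)
  have h1 : (n m + k - 1).choose (k - 1) ≤ (m + k) ^ k :=
    calc _ ≤ (n m + k - 1) ^ (k - 1) := Nat.choose_le_pow _ _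
      _ ≤ (m + k) ^ (k - 1) := Nat.pow_le_pow_left (by have := hn m hm; omega) _
      _ ≤ (m + k) ^ k := Nat.pow_le_pow_right (by omega) (by omega)
  have h2 : (k:ℝ) * Real.log ((m:ℝ) + k) = Real.log (((m + k) ^ k : ℕ) : ℝ) := by
    push_cast; rw [Real.log_pow]
  rw [h2]
  rcases Nat.eq_zero_or_pos ((n m + k - 1).choose (k - 1)) with h0 | h0
  · rw [h0]; simp only [Nat.cast_zero, Real.log_zero]; exact Real.log_natCast_nonneg _
  · exact Real.log_le_log (by exact_mod_cast h0) (by exact_mod_cast h1)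

lemma G_lim (n : ℕ → ℕ) (hn : ∀ m, 1 ≤ m → n m ≤ m) (a : ℝ)
    (ha : Tendsto (fun m : ℕ => (n m : ℝ) / m) atTop (nhds a)) :
    Tendsto (fun m : ℕ => (Real.log ((n m).factorial : ℝ) - n m * Real.log m + n m) / m)
      atTop (nhds (a * Real.log a)) := by
  have h1 : Tendsto (fun m : ℕ => ((n m : ℝ) / m) * Real.log ((n m : ℝ) / m)) atTop
      (nhds (a * Real.log a)) := (Real.continuous_mul_log.tendsto a).comp ha
  have h2 : Tendsto (fun m : ℕ => ((n m : ℝ) / m) * Real.log ((n m : ℝ) / m)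
      + (Real.log ((m:ℝ) + 0) / m + 1 / m)) atTop (nhds (a * Real.log a)) := by
    have := h1.add ((log_add_div 0).add (tendsto_const_div_atTop_nhds_zero_nat (1:ℝ)))
    simpa using this
  have key : ∀ m : ℕ, 1 ≤ m → ((n m : ℝ) / m) * Real.log ((n m : ℝ) / m)
      = (n m * Real.log (n m) - n m * Real.log m) / m := by
    intro m hm
    have hm' : (m:ℝ) ≠ 0 := by positivity
    rcases Nat.eq_zero_or_pos (n m) with h0 | h0
    · simp [h0]
    · rw [Real.log_div (by positivity) hm']; ring
  refine tendsto_of_tendsto_of_tendsto_of_le_of_le' h1 h2 ?_ ?_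
  · filter_upwards [eventually_ge_atTop 1] with m hm
    rw [key m hm]
    apply div_le_div_of_nonneg_right _ (Nat.cast_nonneg _)
    have := logfac_lower (n m)
    linarith
  · filter_upwards [eventually_ge_atTop 1] with m hm
    rw [key m hm, ← add_div, ← add_div]
    apply div_le_div_of_nonneg_right _ (Nat.cast_nonneg _)
    have := logfac_upper (n m)
    have h3 : Real.log (n m : ℝ) ≤ Real.log m := by
      rcases Nat.eq_zero_or_pos (n m) with h0 | h0
      · rw [h0]; simp only [Nat.cast_zero, Real.log_zero]; exact Real.log_natCast_nonneg _
      · exact Real.log_le_log (by exact_mod_cast h0) (by exact_mod_cast hn m hm)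
    rw [add_zero]
    linarith

lemma fam_lim {ι : Type*} [Fintype ι] (n : ℕ → ι → ℕ)
    (hn : ∀ m, 1 ≤ m → ∑ i, n m i = m) (a : ι → ℝ)
    (ha : ∀ i, Tendsto (fun m : ℕ => (n m i : ℝ) / m) atTop (nhds (a i))) :
    Tendsto (fun m : ℕ => (∑ i, Real.log ((n m i).factorial : ℝ)
      - Real.log (m.factorial : ℝ)) / m) atTop (nhds (∑ i, a i * Real.log (a i))) := by
  have h1 := tendsto_finsetSum (Finset.univ : Finset ι) (fun i _ =>
    G_lim (fun m => n m i) (fun m hm => by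
      calc n m i ≤ ∑ i, n m i := Finset.single_le_sum (f := n m) (fun _ _ => Nat.zero_le _) (Finset.mem_univ i)
        _ = m := hn m hm) (a i) (ha i))
  have h2 := G_lim (fun m => m) (fun m _ => le_rfl) 1 (by
    refine tendsto_const_nhds.congr' ?_
    filter_upwards [eventually_ge_atTop 1] with m hm
    have hm' : (m:ℝ) ≠ 0 := by positivity
    field_simp)
  have h3 := h1.sub h2
  simp only [Real.log_one, mul_zero, sub_zero] at h3
  refine h3.congr' ?_
  filter_upwards [eventually_ge_atTop 1] with m hm
  have h4 : ∑ i, (n m i : ℝ) = m := by exact_mod_cast hn m hm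
  rw [← Finset.sum_div, ← sub_div, Finset.sum_add_distrib, Finset.sum_sub_distrib,
    ← Finset.sum_mul, h4]
  congr 1; ring

lemma mutualInfo_eq {X Y : Type*} [Fintype X] [Fintype Y] (q : X × Y → ℝ) (hq : ∀ z, 0 ≤ q z) :
    mutualInfo q = ∑ z, q z * Real.log (q z)
      - ∑ x, (∑ y, q (x, y)) * Real.log (∑ y, q (x, y))
      - ∑ y, (∑ x, q (x, y)) * Real.log (∑ x, q (x, y)) := by
  have h1 : ∑ x, (∑ y, q (x, y)) * Real.log (∑ y, q (x, y))
      = ∑ z : X × Y, q z * Real.log (∑ y, q (z.1, y)) := by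
    rw [Fintype.sum_prod_type]; simp only [Finset.sum_mul]
  have h2 : ∑ y, (∑ x, q (x, y)) * Real.log (∑ x, q (x, y))
      = ∑ z : X × Y, q z * Real.log (∑ x, q (x, z.2)) := by
    rw [Fintype.sum_prod_type_right]; simp only [Finset.sum_mul]
  rw [h1, h2, ← Finset.sum_sub_distrib, ← Finset.sum_sub_distrib, mutualInfo]
  refine Finset.sum_congr rfl fun z _ => ?_
  obtain ⟨x, y⟩ := z
  rcases (hq (x, y)).eq_or_lt with h | h
  · simp [← h]
  · have hx : 0 < ∑ y, q (x, y) := h.trans_le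
      (Finset.single_le_sum (f := fun y => q (x, y)) (fun _ _ => hq _) (Finset.mem_univ y))
    have hy : 0 < ∑ x, q (x, y) := h.trans_le
      (Finset.single_le_sum (f := fun x => q (x, y)) (fun _ _ => hq _) (Finset.mem_univ x))
    simp only
    rw [Real.log_div h.ne' (by positivity), Real.log_mul hx.ne' hy.ne']
    ring

/-- if the empirical edge frequencies of a sequence of graph samples
converge to a joint pmf `p`, then for any fixed coclustering model `M`,
`c_m(M)/m → H(p_S) + H(p_T) − I((f_S,f_T)∗p)`. -/
theorem modl_criterion_limit
    {S T : Type*} [Fintype S] [Fintype T]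
    (hS : 1 ≤ Fintype.card S) (hT : 1 ≤ Fintype.card T)
    (p : S × T → ℝ) (hp0 : ∀ z, 0 ≤ p z) (hp1 : ∑ z : S × T, p z = 1)
    (M : CoclusterModel S T)
    (w : ℕ → S → T → ℕ)
    (hw : ∀ m : ℕ, 1 ≤ m → (∑ i : S, ∑ j : T, w m i j) = m)
    (hconv : ∀ i j, Tendsto (fun m : ℕ => (w m i j : ℝ) / m) atTop (nhds (p (i, j)))) :
    Tendsto (fun m : ℕ => cCrit M (w m) m / m) atTop
      (nhds (shannonEntropy (fun i : S => ∑ j : T, p (i, j))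
        + shannonEntropy (fun j : T => ∑ i : S, p (i, j))
        - mutualInfo (pushJoint M.fS M.fT p))) := by
  set q := pushJoint M.fS M.fT p with hqdef
  have hq0 : ∀ z, 0 ≤ q z := fun z => Finset.sum_nonneg fun i _ => Finset.sum_nonneg fun j _ => by
    split_ifs
    · exact hp0 _
    · exact le_rfl
  have hco : ∀ κ lam, Tendsto (fun m : ℕ => (coCount M (w m) κ lam : ℝ) / m) atTop
      (nhds (q (κ, lam))) := by
    intro κ lam
    have : ∀ m : ℕ, (coCount M (w m) κ lam : ℝ) / m
        = ∑ i, ∑ j, if M.fS i = κ ∧ M.fT j = lam then (w m i j : ℝ) / m else 0 := by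
      intro m
      simp only [coCount, Nat.cast_sum, Finset.sum_div]
      refine Finset.sum_congr rfl fun i _ => Finset.sum_congr rfl fun j _ => ?_
      split_ifs <;> simp
    simp only [this]
    refine tendsto_finsetSum _ fun i _ => tendsto_finsetSum _ fun j _ => ?_
    by_cases h : M.fS i = κ ∧ M.fT j = lam
    · simp only [h, and_self, if_true]; exact hconv i j
    · simp only [h, if_false]; exact tendsto_const_nhds
  have tot : ∀ m, 1 ≤ m → ∑ κ, ∑ lam, coCount M (w m) κ lam = m := fun m hm => by
    rw [coCount_sum, hw m hm]
  have tot' : ∀ m, 1 ≤ m → ∑ lam, ∑ κ, coCount M (w m) κ lam = m := fun m hm => by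
    rw [Finset.sum_comm, tot m hm]
  have hA := fam_lim (fun m (z : Fin M.kS × Fin M.kT) => coCount M (w m) z.1 z.2)
    (fun m hm => by rw [Fintype.sum_prod_type]; exact tot m hm) q (fun z => hco z.1 z.2)
  have hB := fam_lim (fun m κ => ∑ lam, coCount M (w m) κ lam) tot
    (fun κ => ∑ lam, q (κ, lam)) (fun κ => by
      simp only [Nat.cast_sum, Finset.sum_div]
      exact tendsto_finsetSum _ fun lam _ => hco κ lam)
  have hC := fam_lim (fun m lam => ∑ κ, coCount M (w m) κ lam) tot'
    (fun lam => ∑ κ, q (κ, lam)) (fun lam => by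
      simp only [Nat.cast_sum, Finset.sum_div]
      exact tendsto_finsetSum _ fun κ _ => hco κ lam)
  have hD := fam_lim (fun m i => ∑ j, w m i j) hw
    (fun i => ∑ j, p (i, j)) (fun i => by
      simp only [Nat.cast_sum, Finset.sum_div]
      exact tendsto_finsetSum _ fun j _ => hconv i j)
  have hE := fam_lim (fun m j => ∑ i, w m i j)
    (fun m hm => by rw [Finset.sum_comm, hw m hm])
    (fun j => ∑ i, p (i, j)) (fun j => by
      simp only [Nat.cast_sum, Finset.sum_div]
      exact tendsto_finsetSum _ fun i _ => hconv i j)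
  have h0 := tendsto_const_div_atTop_nhds_zero_nat
    (Real.log (Fintype.card S : ℝ) + Real.log (Fintype.card T : ℝ)
      + Real.log (bellPartial (Fintype.card S) M.kS : ℝ)
      + Real.log (bellPartial (Fintype.card T) M.kT : ℝ))
  have h1 := choose_lim (fun m => m) (fun m _ => le_rfl) (M.kS * M.kT)
  have h2 := tendsto_finsetSum (Finset.univ : Finset (Fin M.kS)) (fun κ _ =>
    choose_lim (fun m => ∑ lam, coCount M (w m) κ lam) (fun m hm => by
      refine le_trans ?_ (tot m hm).le
      exact Finset.single_le_sum (f := fun κ => ∑ lam, coCount M (w m) κ lam)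
        (fun _ _ => Nat.zero_le _) (Finset.mem_univ κ))
      (Finset.univ.filter (fun i : S => M.fS i = κ)).card)
  have h3 := tendsto_finsetSum (Finset.univ : Finset (Fin M.kT)) (fun lam _ =>
    choose_lim (fun m => ∑ κ, coCount M (w m) κ lam) (fun m hm => by
      refine le_trans ?_ (tot' m hm).le
      exact Finset.single_le_sum (f := fun lam => ∑ κ, coCount M (w m) κ lam)
        (fun _ _ => Nat.zero_le _) (Finset.mem_univ lam))
      (Finset.univ.filter (fun j : T => M.fT j = lam)).card)
  have H := (((((((h0.add h1).add h2).add h3).sub hA).add hB).sub hD).add hC).sub hE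
  rw [mutualInfo_eq q hq0]
  unfold shannonEntropy
  convert H using 1
  · funext m
    simp only [← Finset.sum_div, ← add_div, ← sub_div]
    rw [Fintype.sum_prod_type]
    unfold cCrit
    congr 1
    ring
  · congr 1
    simp only [Finset.sum_const_zero]
    ring
end

section
/- Fix a joint probability mass function p on S × T. Suppose (m_{ij}(m))_{m≥1} is a sequence of graph samples, where the sample of index m has m edges, such that m_{ij}(m)/m → p(i,j) as m → ∞ for every (i,j) ∈ S × T. Then (min_M c_m(M))/m converges, as m → ∞, to the joint Shannon entropy H(p), where the minimum is taken over the (finite) set of all coclustering models M = (f_S, f_T). -/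
open Finset Filter

set_option linter.unusedSectionVars false
section helpers
variable {S T K L : Type*} [Fintype S] [Fintype T] [Fintype K] [Fintype L] [DecidableEq K] [DecidableEq L]

theorem aux_sum_push {R : Type*} [CommSemiring R] (f : S → K) (g : T → L) (F : K → L → R) (u : S → T → R) :
    ∑ κ, ∑ l, F κ l * (∑ i, ∑ j, if f i = κ ∧ g j = l then u i j else 0)
      = ∑ i, ∑ j, F (f i) (g j) * u i j := by
  simp_rw [Finset.mul_sum]
  have h1 : ∀ κ, ∑ l, ∑ i, ∑ j, F κ l * (if f i = κ ∧ g j = l then u i j else 0)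
      = ∑ i, ∑ j, ∑ l, F κ l * (if f i = κ ∧ g j = l then u i j else 0) := by
    intro κ
    rw [Finset.sum_comm]
    exact Finset.sum_congr rfl fun i _ => Finset.sum_comm
  simp_rw [h1]
  rw [Finset.sum_comm]
  refine Finset.sum_congr rfl fun i _ => ?_
  rw [Finset.sum_comm]
  refine Finset.sum_congr rfl fun j _ => ?_
  simp [ite_and]

theorem aux_rows {R : Type*} [CommSemiring R] (f : S → K) (g : T → L) (u : S → T → R) (κ : K) :
    ∑ l, (∑ i, ∑ j, if f i = κ ∧ g j = l then u i j else 0)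
      = ∑ i, if f i = κ then ∑ j, u i j else 0 := by
  rw [Finset.sum_comm]
  refine Finset.sum_congr rfl fun i _ => ?_
  rw [Finset.sum_comm]
  by_cases h : f i = κ <;> simp [h]

theorem aux_cols {R : Type*} [CommSemiring R] (f : S → K) (g : T → L) (u : S → T → R) (l : L) :
    ∑ κ, (∑ i, ∑ j, if f i = κ ∧ g j = l then u i j else 0)
      = ∑ j, if g j = l then ∑ i, u i j else 0 := by
  rw [Finset.sum_comm]
  simp_rw [Finset.sum_comm (s := (Finset.univ : Finset K))]
  rw [Finset.sum_comm]
  refine Finset.sum_congr rfl fun i _ => ?_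
  by_cases h : g i = l <;> simp [h]

theorem aux_dpi (f : S → K) (g : T → L) (p : S → T → ℝ) (hp : ∀ i j, 0 ≤ p i j)
    (P : K → L → ℝ) (hP : ∀ κ l, P κ l = ∑ i, ∑ j, if f i = κ ∧ g j = l then p i j else 0) :
    ∑ κ, ∑ l, P κ l * Real.log (P κ l) - ∑ κ, (∑ l, P κ l) * Real.log (∑ l, P κ l)
      - ∑ l, (∑ κ, P κ l) * Real.log (∑ κ, P κ l)
    ≤ ∑ i, ∑ j, p i j * Real.log (p i j) - ∑ i, (∑ j, p i j) * Real.log (∑ j, p i j)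
      - ∑ j, (∑ i, p i j) * Real.log (∑ i, p i j) := by
  have hP0 : ∀ κ l, 0 ≤ P κ l := fun κ l => by
    rw [hP]; exact Finset.sum_nonneg fun i _ => Finset.sum_nonneg fun j _ => by
      split_ifs <;> simp [hp]
  set A : K → ℝ := fun κ => ∑ l, P κ l with hA
  set B : L → ℝ := fun l => ∑ κ, P κ l with hB
  set a : S → ℝ := fun i => ∑ j, p i j with ha
  set b : T → ℝ := fun j => ∑ i, p i j with hb
  have hA0 : ∀ κ, 0 ≤ A κ := fun κ => Finset.sum_nonneg fun _ _ => hP0 _ _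
  have hB0 : ∀ κ, 0 ≤ B κ := fun κ => Finset.sum_nonneg fun _ _ => hP0 _ _
  have ha0 : ∀ κ, 0 ≤ a κ := fun κ => Finset.sum_nonneg fun _ _ => hp _ _
  have hb0 : ∀ κ, 0 ≤ b κ := fun κ => Finset.sum_nonneg fun _ _ => hp _ _
  have key : ∀ F : K → L → ℝ, ∑ κ, ∑ l, F κ l * P κ l = ∑ i, ∑ j, F (f i) (g j) * p i j := by
    intro F; simp_rw [hP]; exact aux_sum_push f g F p
  have hAr : ∀ κ, A κ = ∑ i, if f i = κ then a i else 0 := fun κ => by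
    simp only [hA, hP]; exact aux_rows f g p κ
  have hBr : ∀ l, B l = ∑ j, if g j = l then b j else 0 := fun κ => by
    simp only [hB, hP]; exact aux_cols f g p κ
  have e1 : ∑ κ, ∑ l, P κ l * Real.log (P κ l) = ∑ i, ∑ j, p i j * Real.log (P (f i) (g j)) := by
    have := key (fun κ l => Real.log (P κ l))
    simpa only [mul_comm] using this
  have e2 : ∑ κ, A κ * Real.log (A κ) = ∑ i, ∑ j, p i j * Real.log (A (f i)) := by
    have := key (fun κ l => Real.log (A κ))
    simp only [mul_comm (Real.log _)] at this
    rw [← this]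
    exact Finset.sum_congr rfl fun κ _ => by rw [← Finset.sum_mul]
  have e3 : ∑ l, B l * Real.log (B l) = ∑ i, ∑ j, p i j * Real.log (B (g j)) := by
    have := key (fun κ l => Real.log (B l))
    simp only [mul_comm (Real.log _)] at this
    rw [← this, Finset.sum_comm]
    exact Finset.sum_congr rfl fun κ _ => by rw [← Finset.sum_mul]
  have e4 : ∑ i, a i * Real.log (a i) = ∑ i, ∑ j, p i j * Real.log (a i) :=
    Finset.sum_congr rfl fun κ _ => by rw [← Finset.sum_mul]
  have e5 : ∑ j, b j * Real.log (b j) = ∑ i, ∑ j, p i j * Real.log (b j) := by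
    rw [Finset.sum_comm]
    exact Finset.sum_congr rfl fun κ _ => by rw [← Finset.sum_mul]
  set r : S → T → ℝ := fun i j => P (f i) (g j) / (A (f i) * B (g j)) * (a i * b j) with hr
  have hrsum : ∑ i, ∑ j, r i j ≤ ∑ i, ∑ j, p i j := by
    have h1 := aux_sum_push f g (fun κ l => P κ l / (A κ * B l)) (fun i j => a i * b j)
    have h2 := key (fun _ _ => 1)
    simp only [one_mul] at h2
    rw [← h2]
    change ∑ i, ∑ j, P (f i) (g j) / (A (f i) * B (g j)) * (a i * b j) ≤ _
    rw [← h1]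
    refine Finset.sum_le_sum fun κ _ => Finset.sum_le_sum fun l _ => ?_
    have h3 : (∑ i, ∑ j, if f i = κ ∧ g j = l then a i * b j else 0) = A κ * B l := by
      rw [hAr, hBr, Finset.sum_mul_sum]
      refine Finset.sum_congr rfl fun i _ => Finset.sum_congr rfl fun j _ => ?_
      by_cases h : f i = κ <;> by_cases h' : g j = l <;> simp [h, h']
    rw [h3]
    by_cases h : A κ * B l = 0
    · rw [h]; simpa using hP0 κ l
    · rw [div_mul_cancel₀ _ h]
  have main : ∀ i j, p i j * Real.log (P (f i) (g j)) - p i j * Real.log (A (f i))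
      - p i j * Real.log (B (g j)) - p i j * Real.log (p i j) + p i j * Real.log (a i)
      + p i j * Real.log (b j) ≤ r i j - p i j := by
    intro i j
    rcases (hp i j).eq_or_lt with h | h
    · rw [← h]
      simp only [zero_mul, hr]
      have := div_nonneg (hP0 (f i) (g j)) (mul_nonneg (hA0 (f i)) (hB0 (g j)))
      have := mul_nonneg this (mul_nonneg (ha0 i) (hb0 j))
      linarith
    · have i1 : p i j ≤ a i := Finset.single_le_sum (f := fun j => p i j) (fun _ _ => hp _ _) (Finset.mem_univ j)
      have i2 : p i j ≤ b j := Finset.single_le_sum (f := fun i => p i j) (fun _ _ => hp _ _) (Finset.mem_univ i)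
      have hn : ∀ i' j', 0 ≤ (if f i' = f i ∧ g j' = g j then p i' j' else 0) := fun i' j' => by
        split_ifs <;> simp [hp]
      have i3 : p i j ≤ P (f i) (g j) := by
        rw [hP]
        have s1 := Finset.single_le_sum (f := fun i' => ∑ j', if f i' = f i ∧ g j' = g j then p i' j' else 0)
          (fun i' _ => Finset.sum_nonneg fun j' _ => hn i' j') (Finset.mem_univ i)
        have s2 := Finset.single_le_sum (f := fun j' => if f i = f i ∧ g j' = g j then p i j' else 0)
          (fun j' _ => hn i j') (Finset.mem_univ j)
        simp only [true_and, if_true] at s1 s2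
        exact s2.trans s1
      have i4 : P (f i) (g j) ≤ A (f i) :=
        Finset.single_le_sum (f := fun l => P (f i) l) (fun _ _ => hP0 _ _) (Finset.mem_univ (g j))
      have i5 : P (f i) (g j) ≤ B (g j) :=
        Finset.single_le_sum (f := fun l => P l (g j)) (fun _ _ => hP0 _ _) (Finset.mem_univ (f i))
      have q1 : 0 < a i := by linarith
      have q2 : 0 < b j := by linarith
      have q3 : 0 < P (f i) (g j) := by linarith
      have q4 : 0 < A (f i) := by linarith
      have q5 : 0 < B (g j) := by linarith
      have hrp : 0 < r i j := by simp only [hr]; positivity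
      have hl := Real.log_le_sub_one_of_pos (div_pos hrp h)
      have hlog : Real.log (r i j / p i j) = Real.log (P (f i) (g j)) - Real.log (A (f i))
          - Real.log (B (g j)) - Real.log (p i j) + Real.log (a i) + Real.log (b j) := by
        simp only [hr]
        rw [Real.log_div (by positivity) h.ne', Real.log_mul (by positivity) (by positivity),
          Real.log_div q3.ne' (by positivity), Real.log_mul q4.ne' q5.ne', Real.log_mul q1.ne' q2.ne']
        ring
      rw [hlog] at hl
      have := mul_le_mul_of_nonneg_left hl h.le
      rw [mul_sub (p i j) (r i j / p i j) 1, mul_div_cancel₀ _ h.ne'] at this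
      linarith
  have tot := Finset.sum_le_sum fun i (_ : i ∈ Finset.univ) => Finset.sum_le_sum fun j (_ : j ∈ Finset.univ) => main i j
  simp only [Finset.sum_sub_distrib, Finset.sum_add_distrib] at tot
  rw [e1, e2, e3, e4, e5]
  linarith

theorem aux_stirling (n : ℕ) : 0 ≤ Real.log (n.factorial : ℝ) - (n * Real.log n - n) ∧
    Real.log (n.factorial : ℝ) - (n * Real.log n - n) ≤ 1 + Real.log n := by
  induction n with
  | zero => simp
  | succ n ih =>
    rcases Nat.eq_zero_or_pos n with h | h
    · subst h; simp
    have hn : (0:ℝ) < n := by exact_mod_cast h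
    have h1 : Real.log ((n+1).factorial : ℝ) = Real.log (n+1) + Real.log (n.factorial : ℝ) := by
      rw [Nat.factorial_succ]; push_cast
      rw [Real.log_mul (by positivity) (by positivity)]
    rw [h1]; push_cast
    have u := Real.log_le_sub_one_of_pos (x := ((n:ℝ)+1)/n) (by positivity)
    have v := Real.log_le_sub_one_of_pos (x := (n:ℝ)/(n+1)) (by positivity)
    rw [Real.log_div (by positivity) (by positivity)] at u v
    have u' : n * (Real.log (n+1) - Real.log n) ≤ 1 := by
      have := mul_le_mul_of_nonneg_left u hn.le
      have e : (n:ℝ) * (((n:ℝ)+1)/n - 1) = 1 := by field_simp; ring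
      linarith
    have v' : (n+1) * (Real.log n - Real.log (n+1)) ≤ -1 := by
      have := mul_le_mul_of_nonneg_left v (by positivity : (0:ℝ) ≤ n+1)
      have e : ((n:ℝ)+1) * ((n:ℝ)/(n+1) - 1) = -1 := by field_simp; ring
      linarith
    constructor <;> nlinarith [ih.1, ih.2]

theorem aux_logdiv (c k : ℝ) : Tendsto (fun m : ℕ => (c + k * Real.log m) / (m:ℝ)) atTop (nhds 0) := by
  have h1 : Tendsto (fun m : ℕ => Real.log m / (m:ℝ)) atTop (nhds 0) :=
    (Real.isLittleO_log_id_atTop.tendsto_div_nhds_zero).comp tendsto_natCast_atTop_atTop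
  have h2 : Tendsto (fun m : ℕ => c / (m:ℝ)) atTop (nhds 0) := tendsto_const_div_atTop_nhds_zero_nat c
  have := h2.add (h1.const_mul k)
  simp only [mul_zero, add_zero] at this
  refine this.congr fun m => by ring

theorem aux_fact (n : ℕ → ℕ) (q : ℝ) (hn : ∀ m, 1 ≤ m → n m ≤ m)
    (h : Tendsto (fun m => (n m : ℝ) / m) atTop (nhds q)) :
    Tendsto (fun m : ℕ => (Real.log ((n m).factorial : ℝ) - n m * Real.log m) / m) atTop
      (nhds (q * Real.log q - q)) := by
  have he : Tendsto (fun m : ℕ => (Real.log ((n m).factorial : ℝ) - (n m * Real.log (n m) - n m)) / m)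
      atTop (nhds 0) := by
    refine tendsto_of_tendsto_of_tendsto_of_le_of_le' tendsto_const_nhds (aux_logdiv 1 1) ?_ ?_
    · exact Eventually.of_forall fun m => div_nonneg (aux_stirling _).1 (by positivity)
    · filter_upwards [eventually_ge_atTop 1] with m hm
      gcongr
      refine (aux_stirling _).2.trans ?_
      rw [one_mul]
      refine add_le_add le_rfl ?_
      rcases Nat.eq_zero_or_pos (n m) with h | h
      · rw [h]; simpa using Real.log_natCast_nonneg m
      · exact Real.log_le_log (by exact_mod_cast h) (by exact_mod_cast hn m hm)
  have hg := ((Real.continuous_mul_log.tendsto q).comp h).sub h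
  have := hg.add he
  rw [add_zero] at this
  refine this.congr' ?_
  filter_upwards [eventually_ge_atTop 1] with m hm
  have hm' : (0:ℝ) < m := by exact_mod_cast hm
  simp only [Function.comp]
  rcases Nat.eq_zero_or_pos (n m) with h | h
  · rw [h]; simp
  · have : (0:ℝ) < n m := by exact_mod_cast h
    rw [Real.log_div this.ne' hm'.ne']
    field_simp
    ring

theorem aux_choose (n : ℕ → ℕ) (k : ℕ) (hn : ∀ m, 1 ≤ m → n m ≤ m) :
    Tendsto (fun m : ℕ => Real.log (((n m + k - 1).choose (k - 1) : ℕ) : ℝ) / m) atTop (nhds 0) := by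
  refine tendsto_of_tendsto_of_tendsto_of_le_of_le' tendsto_const_nhds
    (aux_logdiv (k * Real.log (k+1)) k) ?_ ?_
  · exact Eventually.of_forall fun m => div_nonneg (Real.log_natCast_nonneg _) (by positivity)
  · filter_upwards [eventually_ge_atTop 1] with m hm
    gcongr
    have hm' : (0:ℝ) < m := by exact_mod_cast hm
    have h1 : (n m + k - 1).choose (k - 1) ≤ ((k+1) * m) ^ k := by
      refine (Nat.choose_le_pow _ _).trans ?_
      have : n m + k - 1 ≤ (k+1) * m := by
        have := hn m hm
        have : k ≤ k * m := Nat.le_mul_of_pos_right k hm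
        rw [add_mul]; omega
      refine (Nat.pow_le_pow_left this _).trans (Nat.pow_le_pow_right (by positivity) (by omega))
    have h2 : (0:ℕ) < (n m + k - 1).choose (k - 1) := by
      apply Nat.choose_pos; omega
    have h3 := Real.log_le_log (by exact_mod_cast h2) (Nat.cast_le (α := ℝ).2 h1)
    refine h3.trans (le_of_eq ?_)
    push_cast
    rw [Real.log_pow, Real.log_mul (by positivity) (by positivity)]
    ring
end helpers

/-- Pushed-forward limit mass. -/
noncomputable def auxP {S T : Type*} [Fintype S] [Fintype T] (p : S × T → ℝ)
    (M : CoclusterModel S T) (κ : Fin M.kS) (l : Fin M.kT) : ℝ :=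
  ∑ i : S, ∑ j : T, if M.fS i = κ ∧ M.fT j = l then p (i, j) else 0

/-- Limit of the criterion. -/
noncomputable def auxLim {S T : Type*} [Fintype S] [Fintype T] (p : S × T → ℝ)
    (M : CoclusterModel S T) : ℝ :=
  - ∑ κ, ∑ l, auxP p M κ l * Real.log (auxP p M κ l)
  + ∑ κ, (∑ l, auxP p M κ l) * Real.log (∑ l, auxP p M κ l)
  - ∑ i : S, (∑ j : T, p (i, j)) * Real.log (∑ j : T, p (i, j))
  + ∑ l, (∑ κ, auxP p M κ l) * Real.log (∑ κ, auxP p M κ l)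
  - ∑ j : T, (∑ i : S, p (i, j)) * Real.log (∑ i : S, p (i, j))

theorem aux_sumfact {ι : Type*} [Fintype ι] (n : ℕ → ι → ℕ) (q : ι → ℝ)
    (hn : ∀ m, 1 ≤ m → ∑ x, n m x = m)
    (h : ∀ x, Tendsto (fun m => (n m x : ℝ) / m) atTop (nhds (q x))) :
    Tendsto (fun m : ℕ => (∑ x, Real.log ((n m x).factorial : ℝ) - m * Real.log m) / m) atTop
      (nhds (∑ x, q x * Real.log (q x) - 1)) := by
  have hle : ∀ x m, 1 ≤ m → n m x ≤ m := fun x m hm => by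
    conv_rhs => rw [← hn m hm]
    exact Finset.single_le_sum (f := fun x => n m x) (fun _ _ => Nat.zero_le _) (Finset.mem_univ x)
  have h1 := tendsto_finset_sum Finset.univ fun x _ => aux_fact (fun m => n m x) (q x) (hle x) (h x)
  have hq : ∑ x, q x = 1 := by
    have h2 := tendsto_finset_sum Finset.univ fun x _ => h x
    refine tendsto_nhds_unique h2 (tendsto_const_nhds.congr' ?_)
    filter_upwards [eventually_ge_atTop 1] with m hm
    have hm' : (0:ℝ) < m := by exact_mod_cast hm
    rw [← Finset.sum_div, ← Nat.cast_sum, hn m hm, div_self hm'.ne']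
  rw [Finset.sum_sub_distrib, hq] at h1
  refine h1.congr' ?_
  filter_upwards [eventually_ge_atTop 1] with m hm
  rw [← Finset.sum_div, Finset.sum_sub_distrib, ← Finset.sum_mul, ← Nat.cast_sum, hn m hm]

theorem aux_lim {S T : Type*} [Fintype S] [Fintype T]
    (p : S × T → ℝ)
    (w : ℕ → S → T → ℕ)
    (hw : ∀ m : ℕ, 1 ≤ m → (∑ i : S, ∑ j : T, w m i j) = m)
    (hconv : ∀ i j, Tendsto (fun m : ℕ => (w m i j : ℝ) / m) atTop (nhds (p (i, j))))
    (M : CoclusterModel S T) :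
    Tendsto (fun m : ℕ => cCrit M (w m) m / m) atTop (nhds (auxLim p M)) := by
  have tot : ∀ m, 1 ≤ m → ∑ κ, ∑ l, coCount M (w m) κ l = m := fun m hm => by
    have := aux_sum_push M.fS M.fT (fun _ _ => 1) (w m)
    simp only [one_mul] at this
    rw [hw m hm] at this
    exact this
  have tot' : ∀ m, 1 ≤ m → ∑ l, ∑ κ, coCount M (w m) κ l = m := fun m hm => by
    rw [Finset.sum_comm]; exact tot m hm
  have hw' : ∀ m, 1 ≤ m → ∑ j, ∑ i, w m i j = m := fun m hm => by
    rw [Finset.sum_comm]; exact hw m hm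
  have c1 : ∀ κ l, Tendsto (fun m => (coCount M (w m) κ l : ℝ) / m) atTop (nhds (auxP p M κ l)) := by
    intro κ l
    have : ∀ i j, Tendsto (fun m : ℕ => ((if M.fS i = κ ∧ M.fT j = l then w m i j else 0 : ℕ) : ℝ) / m) atTop
        (nhds (if M.fS i = κ ∧ M.fT j = l then p (i, j) else 0)) := by
      intro i j
      split_ifs
      · exact hconv i j
      · simp
    have h := tendsto_finset_sum Finset.univ fun i _ => tendsto_finset_sum Finset.univ fun j _ => this i j
    refine h.congr fun m => ?_
    simp only [coCount, ← Finset.sum_div, ← Nat.cast_sum]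
  have c2 : ∀ κ, Tendsto (fun m => ((∑ l, coCount M (w m) κ l : ℕ) : ℝ) / m) atTop
      (nhds (∑ l, auxP p M κ l)) := fun κ =>
    (tendsto_finset_sum Finset.univ fun l _ => c1 κ l).congr fun m => by
      simp only [← Finset.sum_div, ← Nat.cast_sum]
  have c3 : ∀ l, Tendsto (fun m => ((∑ κ, coCount M (w m) κ l : ℕ) : ℝ) / m) atTop
      (nhds (∑ κ, auxP p M κ l)) := fun l =>
    (tendsto_finset_sum Finset.univ fun κ _ => c1 κ l).congr fun m => by
      simp only [← Finset.sum_div, ← Nat.cast_sum]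
  have c4 : ∀ i, Tendsto (fun m => ((∑ j, w m i j : ℕ) : ℝ) / m) atTop
      (nhds (∑ j, p (i, j))) := fun i =>
    (tendsto_finset_sum Finset.univ fun j _ => hconv i j).congr fun m => by
      simp only [← Finset.sum_div, ← Nat.cast_sum]
  have c5 : ∀ j, Tendsto (fun m => ((∑ i, w m i j : ℕ) : ℝ) / m) atTop
      (nhds (∑ i, p (i, j))) := fun j =>
    (tendsto_finset_sum Finset.univ fun i _ => hconv i j).congr fun m => by
      simp only [← Finset.sum_div, ← Nat.cast_sum]
  have t1 := aux_sumfact (ι := Fin M.kS × Fin M.kT) (fun m z => coCount M (w m) z.1 z.2)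
    (fun z => auxP p M z.1 z.2) (fun m hm => by rw [Fintype.sum_prod_type]; exact tot m hm)
    (fun z => c1 z.1 z.2)
  simp only [Fintype.sum_prod_type] at t1
  have t2 := aux_sumfact (fun m κ => ∑ l, coCount M (w m) κ l) _ tot c2
  have t3 := aux_sumfact (fun m l => ∑ κ, coCount M (w m) κ l) _ tot' c3
  have t4 := aux_sumfact (fun m i => ∑ j, w m i j) _ hw c4
  have t5 := aux_sumfact (fun m j => ∑ i, w m i j) _ hw' c5
  have t0 := aux_sumfact (ι := Unit) (fun m _ => m) (fun _ => 1) (by simp) (fun _ => by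
    refine tendsto_const_nhds.congr' ?_
    filter_upwards [eventually_ge_atTop 1] with m hm
    have hm' : (0:ℝ) < m := by exact_mod_cast hm
    rw [div_self hm'.ne'])
  simp only [Finset.univ_unique, Finset.sum_singleton, Real.log_one, mul_zero] at t0
  have k0 := aux_logdiv (Real.log (Fintype.card S : ℝ) + Real.log (Fintype.card T : ℝ)
  + Real.log (bellPartial (Fintype.card S) M.kS : ℝ)
  + Real.log (bellPartial (Fintype.card T) M.kT : ℝ)) 0
  have k1 := aux_choose (fun m => m) (M.kS * M.kT) (fun _ _ => le_rfl)
  have k2 := tendsto_finset_sum Finset.univ fun κ (_ : κ ∈ Finset.univ) =>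
    aux_choose (fun m => ∑ l, coCount M (w m) κ l)
      (Finset.univ.filter (fun i : S => M.fS i = κ)).card (fun m hm => by
        conv_rhs => rw [← tot m hm]
        exact Finset.single_le_sum (f := fun κ => ∑ l, coCount M (w m) κ l)
          (fun _ _ => Nat.zero_le _) (Finset.mem_univ κ))
  have k3 := tendsto_finset_sum Finset.univ fun l (_ : l ∈ Finset.univ) =>
    aux_choose (fun m => ∑ κ, coCount M (w m) κ l)
      (Finset.univ.filter (fun j : T => M.fT j = l)).card (fun m hm => by
        conv_rhs => rw [← tot' m hm]
        exact Finset.single_le_sum (f := fun l => ∑ κ, coCount M (w m) κ l)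
          (fun _ _ => Nat.zero_le _) (Finset.mem_univ l))
  simp only [← Finset.sum_div, Finset.sum_const_zero] at k2 k3
  have fin := (((((((((k0.add k1).add k2).add k3).add t0).sub t1).add t2).sub t4).add t3).sub t5)
  refine (fin.congr fun m => ?_).trans_eq ?_
  · simp only [cCrit]; ring
  · congr 1; simp only [auxLim]; ring

theorem aux_finite (S T : Type*) [Fintype S] [Fintype T] : Finite (CoclusterModel S T) := by
  let φ : CoclusterModel S T → Σ (a : Fin (Fintype.card S + 1)) (b : Fin (Fintype.card T + 1)),
      (S → Fin a) × (T → Fin b) := fun M =>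
    ⟨⟨M.kS, by simpa [Nat.lt_succ_iff] using Fintype.card_le_of_surjective _ M.fS_surj⟩,
     ⟨M.kT, by simpa [Nat.lt_succ_iff] using Fintype.card_le_of_surjective _ M.fT_surj⟩, (M.fS, M.fT)⟩
  refine Finite.of_injective φ ?_
  rintro ⟨a, b, _, _, f, g, _, _⟩ ⟨a', b', _, _, f', g', _, _⟩ h
  simp only [φ, Sigma.mk.injEq, Fin.mk.injEq] at h
  obtain ⟨rfl, h⟩ := h
  simp only [heq_eq_eq, Sigma.mk.injEq, Fin.mk.injEq] at h
  obtain ⟨rfl, h⟩ := h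
  simp only [heq_eq_eq, Prod.mk.injEq] at h
  obtain ⟨rfl, rfl⟩ := h
  rfl

theorem aux_le {S T : Type*} [Fintype S] [Fintype T] (p : S × T → ℝ) (hp0 : ∀ z, 0 ≤ p z)
    (M : CoclusterModel S T) : shannonEntropy p ≤ auxLim p M := by
  have := aux_dpi M.fS M.fT (fun i j => p (i, j)) (fun i j => hp0 _) (auxP p M) (fun _ _ => rfl)
  simp only [shannonEntropy, auxLim, Fintype.sum_prod_type]
  linarith

/-- The finest model. -/
noncomputable def auxM0 (S T : Type*) [Fintype S] [Fintype T]
    (hS : 1 ≤ Fintype.card S) (hT : 1 ≤ Fintype.card T) : CoclusterModel S T where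
  kS := Fintype.card S
  kT := Fintype.card T
  kS_pos := hS
  kT_pos := hT
  fS := Fintype.equivFin S
  fT := Fintype.equivFin T
  fS_surj := (Fintype.equivFin S).surjective
  fT_surj := (Fintype.equivFin T).surjective

theorem aux_eq {S T : Type*} [Fintype S] [Fintype T]
    (hS : 1 ≤ Fintype.card S) (hT : 1 ≤ Fintype.card T) (p : S × T → ℝ) :
    auxLim p (auxM0 S T hS hT) = shannonEntropy p := by
  classical
  have hP : ∀ i j, auxP p (auxM0 S T hS hT) (Fintype.equivFin S i) (Fintype.equivFin T j) = p (i, j) := by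
    intro i j
    simp [auxP, auxM0, ite_and]
  have sS : ∀ F : Fin (auxM0 S T hS hT).kS → ℝ, ∑ κ, F κ = ∑ i, F (Fintype.equivFin S i) :=
    fun F => ((Fintype.equivFin S).sum_comp F).symm
  have sT : ∀ F : Fin (auxM0 S T hS hT).kT → ℝ, ∑ κ, F κ = ∑ i, F (Fintype.equivFin T i) :=
    fun F => ((Fintype.equivFin T).sum_comp F).symm
  simp only [auxLim, shannonEntropy, Fintype.sum_prod_type, sS, sT, hP]
  ring

/-- if the empirical edge frequencies of a sequence of graph samples
converge to a joint pmf `p`, then `(min_M c_m(M))/m → H(p)`, the joint Shannon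
entropy, the minimum being over all coclustering models. -/
theorem modl_consistency
    {S T : Type*} [Fintype S] [Fintype T]
    (hS : 1 ≤ Fintype.card S) (hT : 1 ≤ Fintype.card T)
    (p : S × T → ℝ) (hp0 : ∀ z, 0 ≤ p z) (hp1 : ∑ z : S × T, p z = 1)
    (w : ℕ → S → T → ℕ)
    (hw : ∀ m : ℕ, 1 ≤ m → (∑ i : S, ∑ j : T, w m i j) = m)
    (hconv : ∀ i j, Tendsto (fun m : ℕ => (w m i j : ℝ) / m) atTop (nhds (p (i, j)))) :
    Tendsto (fun m : ℕ => (⨅ M : CoclusterModel S T, cCrit M (w m) m) / m) atTop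
      (nhds (shannonEntropy p)) := by
  haveI := aux_finite S T
  haveI : Nonempty (CoclusterModel S T) := ⟨auxM0 S T hS hT⟩
  have hl := aux_lim p w hw hconv
  rw [tendsto_order]
  constructor
  · intro a ha
    have hall : ∀ᶠ m : ℕ in atTop, ∀ M : CoclusterModel S T, a < cCrit M (w m) m / m :=
      eventually_all.2 fun M => (tendsto_order.1 (hl M)).1 a (ha.trans_le (aux_le p hp0 M))
    filter_upwards [hall] with m hm
    obtain ⟨M, hM⟩ := exists_eq_ciInf_of_finite (f := fun M : CoclusterModel S T => cCrit M (w m) m)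
    rw [← hM]
    exact hm M
  · intro a ha
    have h0 := hl (auxM0 S T hS hT)
    rw [aux_eq] at h0
    filter_upwards [(tendsto_order.1 h0).2 a ha] with m hm
    refine lt_of_le_of_lt ?_ hm
    gcongr
    exact ciInf_le (Set.finite_range _).bddBelow _
end

section
/- Logarithm of a multinomial coefficient as empirical entropy up to a logarithmic error: for every k ≥ 1 there exists a constant C (depending only on k) such that for every m ≥ 1 and every tuple of natural numbers (m_1, …, m_k) with m_1 + ⋯ + m_k = m, one has |log(m! / (m_1! ⋯ m_k!)) − m·Ĥ| ≤ C·log(m+1), where Ĥ = −Σ_{c : m_c > 0} (m_c/m)·log(m_c/m) is the empirical Shannon entropy of the counts (natural logarithm). -/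
open Finset

lemma aux_step (n : ℕ) (hn : 1 ≤ n) :
    (n : ℝ) * (Real.log (n + 1) - Real.log n) ≤ 1 ∧
    1 ≤ ((n : ℝ) + 1) * (Real.log (n + 1) - Real.log n) := by
  have h0 : (0 : ℝ) < n := by exact_mod_cast hn
  have h1 : (0 : ℝ) < (n : ℝ) + 1 := by positivity
  constructor
  · have := Real.log_le_sub_one_of_pos (div_pos h1 h0)
    rw [Real.log_div h1.ne' h0.ne'] at this
    calc _ ≤ (n : ℝ) * (((n : ℝ) + 1) / n - 1) := by gcongr
      _ = 1 := by field_simp; ring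
  · have := Real.log_le_sub_one_of_pos (div_pos h0 h1)
    rw [Real.log_div h0.ne' h1.ne'] at this
    have h2 : 1 - (n : ℝ) / (n + 1) ≤ Real.log (n + 1) - Real.log n := by linarith
    calc (1 : ℝ) = ((n : ℝ) + 1) * (1 - (n : ℝ) / (n + 1)) := by field_simp; ring
      _ ≤ _ := by gcongr

lemma aux_g (n : ℕ) :
    0 ≤ Real.log ((n + 1).factorial : ℝ) - ((n : ℝ) + 1) * Real.log (n + 1) + (n + 1) ∧
    Real.log ((n + 1).factorial : ℝ) - ((n : ℝ) + 1) * Real.log (n + 1) + (n + 1)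
      ≤ 1 + Real.log (n + 1) := by
  induction n with
  | zero => simp
  | succ n ih =>
    have h := aux_step (n + 1) (by omega)
    rw [Nat.factorial_succ (n + 1), Nat.cast_mul,
      Real.log_mul (by positivity) (by positivity)]
    push_cast at h ⊢
    constructor <;> nlinarith [ih.1, ih.2, h.1, h.2]

lemma aux_g' (m n : ℕ) (hm : 1 ≤ m) (h : n ≤ m) :
    0 ≤ Real.log (n.factorial : ℝ) - (n : ℝ) * Real.log n + n ∧
    Real.log (n.factorial : ℝ) - (n : ℝ) * Real.log n + n ≤ 3 * Real.log ((m : ℝ) + 1) := by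
  have hm' : (1 : ℝ) ≤ m := by exact_mod_cast hm
  have h2 : Real.log 2 ≤ Real.log ((m : ℝ) + 1) :=
    Real.log_le_log (by norm_num) (by linarith)
  have h3 := Real.log_two_gt_d9
  rcases n with _ | n
  · simp; linarith
  · have := aux_g n
    have h4 : Real.log ((n : ℝ) + 1) ≤ Real.log ((m : ℝ) + 1) := by
      apply Real.log_le_log (by positivity)
      have : ((n + 1 : ℕ) : ℝ) ≤ m := by exact_mod_cast h
      push_cast at this
      linarith
    push_cast
    exact ⟨this.1, by linarith [this.2]⟩

/-- for every `k ≥ 1` there is a constant `C` (depending only on `k`)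
such that for every `m ≥ 1` and counts `(m_1,…,m_k)` summing to `m`,
`|log(m!/(m_1!⋯m_k!)) − m·Ĥ| ≤ C·log(m+1)`, where `Ĥ` is the empirical entropy of
the counts. -/
theorem log_multinomial_eq_empirical_entropy_up_to_log
    (k : ℕ) (hk : 1 ≤ k) :
    ∃ C : ℝ, ∀ m : ℕ, 1 ≤ m → ∀ f : Fin k → ℕ, (∑ c, f c) = m →
      |Real.log ((m.factorial : ℝ) / ∏ c : Fin k, ((f c).factorial : ℝ))
          - (m : ℝ) * (-∑ c : Fin k, ((f c : ℝ) / m) * Real.log ((f c : ℝ) / m))|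
        ≤ C * Real.log ((m : ℝ) + 1) := by
  refine ⟨3 * (k + 1), fun m hm f hf => ?_⟩
  have hm0 : (0 : ℝ) < m := by exact_mod_cast hm
  have hle : ∀ c, f c ≤ m := fun c => by
    rw [← hf]; exact Finset.single_le_sum (fun _ _ => Nat.zero_le _) (Finset.mem_univ c)
  have hs : ∑ c, (f c : ℝ) = m := by exact_mod_cast hf
  have hL : 0 ≤ Real.log ((m : ℝ) + 1) := Real.log_nonneg (by linarith)
  have key : Real.log ((m.factorial : ℝ) / ∏ c : Fin k, ((f c).factorial : ℝ))
      - (m : ℝ) * (-∑ c : Fin k, ((f c : ℝ) / m) * Real.log ((f c : ℝ) / m))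
      = (Real.log (m.factorial : ℝ) - (m : ℝ) * Real.log m + m)
        - ∑ c, (Real.log ((f c).factorial : ℝ) - (f c : ℝ) * Real.log (f c) + f c) := by
    rw [Real.log_div (by positivity) (Finset.prod_ne_zero_iff.2 fun c _ => by positivity),
      Real.log_prod (fun c _ => by positivity)]
    have e : (m : ℝ) * (-∑ c : Fin k, ((f c : ℝ) / m) * Real.log ((f c : ℝ) / m))
        = m * Real.log m - ∑ c, (f c : ℝ) * Real.log (f c) := by
      have e1 : ∀ c, (m : ℝ) * (((f c : ℝ) / m) * Real.log ((f c : ℝ) / m))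
          = (f c : ℝ) * Real.log (f c) - f c * Real.log m := by
        intro c
        by_cases h : f c = 0
        · simp [h]
        · have h' : (f c : ℝ) ≠ 0 := by exact_mod_cast h
          rw [Real.log_div h' hm0.ne']
          field_simp
      rw [mul_neg, Finset.mul_sum, Finset.sum_congr rfl (fun c _ => e1 c),
        Finset.sum_sub_distrib, ← Finset.sum_mul, hs]
      ring
    rw [e, Finset.sum_add_distrib, Finset.sum_sub_distrib, hs]
    ring
  rw [key]
  have g := aux_g' m m hm le_rfl
  have s1 : 0 ≤ ∑ c, (Real.log ((f c).factorial : ℝ) - (f c : ℝ) * Real.log (f c) + f c) :=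
    Finset.sum_nonneg fun c _ => (aux_g' m (f c) hm (hle c)).1
  have s2 : ∑ c, (Real.log ((f c).factorial : ℝ) - (f c : ℝ) * Real.log (f c) + f c)
      ≤ k * (3 * Real.log ((m : ℝ) + 1)) := by
    refine (Finset.sum_le_sum fun c _ => (aux_g' m (f c) hm (hle c)).2).trans ?_
    simp
  have hk0 : 0 ≤ (k : ℝ) * Real.log ((m : ℝ) + 1) := by positivity
  rw [abs_le]
  constructor <;> linarith [g.1, g.2]
end
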